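/- Let θ be a real number, suppose G is θ-elementary, and let S be a nonempty subset of V(G). Then S is a θ-barrier set of G if and only if the graph G\S has exactly |S| connected components and each of these components is θ-critical. -/

import Mathlib

open Polynomial

namespace MatchPoly

variable {V : Type*}

/-- The number of `r`-matchings in `G`: sets of `r` edges, no two sharing a vertex. -/
noncomputable def numMatchings (G : SimpleGraph V) (r : ℕ) : ℕ :=
  Nat.card {M : Finset (Sym2 V) // M.card = r ∧ (M : Set (Sym2 V)) ⊆ G.edgeSet ∧
    (M : Set (Sym2 V)).Pairwise fun e f => ∀ v : V, v ∈ e → v ∉ f}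

/-- The matching polynomial `μ(G,x) = ∑ (-1)^r p(G,r) x^(n-2r)`. -/
noncomputable def matchingPoly (G : SimpleGraph V) : Polynomial ℝ :=
  ∑ r ∈ Finset.range (Nat.card V + 1),
    Polynomial.C ((-1 : ℝ) ^ r * (numMatchings G r : ℝ)) *
      (Polynomial.X : Polynomial ℝ) ^ (Nat.card V - 2 * r)

/-- `mult θ G`: the multiplicity of `θ` as a root of `μ(G,x)`. -/
noncomputable def mult (θ : ℝ) (G : SimpleGraph V) : ℕ :=
  (matchingPoly G).rootMultiplicity θ

/-- `G \ X`: the induced subgraph on the complement of the vertex set `X`. -/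
def deleteSet (G : SimpleGraph V) (X : Set V) : SimpleGraph ↥(Xᶜ) :=
  G.induce (Xᶜ)

/-- `G \ v`: delete a single vertex. -/
def deleteVert (G : SimpleGraph V) (v : V) : SimpleGraph ↥({v}ᶜ : Set V) :=
  G.induce ({v}ᶜ : Set V)

/-- `u` is θ-essential: `mult(θ, G\u) = mult(θ,G) - 1`. -/
def IsEssential (θ : ℝ) (G : SimpleGraph V) (u : V) : Prop :=
  mult θ (deleteVert G u) + 1 = mult θ G

/-- `u` is θ-neutral: `mult(θ, G\u) = mult(θ,G)`. -/
def IsNeutral (θ : ℝ) (G : SimpleGraph V) (u : V) : Prop :=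
  mult θ (deleteVert G u) = mult θ G

/-- `u` is θ-positive: `mult(θ, G\u) = mult(θ,G) + 1`. -/
def IsPositive (θ : ℝ) (G : SimpleGraph V) (u : V) : Prop :=
  mult θ (deleteVert G u) = mult θ G + 1

/-- `u` is θ-special: not θ-essential but adjacent to a θ-essential vertex. -/
def IsSpecial (θ : ℝ) (G : SimpleGraph V) (u : V) : Prop :=
  ¬ IsEssential θ G u ∧ ∃ w : V, G.Adj u w ∧ IsEssential θ G w

/-- `A_θ(G)`: the set of θ-special vertices. -/
def specialSet (θ : ℝ) (G : SimpleGraph V) : Set V := {u | IsSpecial θ G u}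

/-- `N_θ(G)`: the set of θ-neutral vertices. -/
def neutralSet (θ : ℝ) (G : SimpleGraph V) : Set V := {u | IsNeutral θ G u}

/-- `P_θ(G)`: the set of θ-positive vertices that are not θ-special. -/
def positiveSet (θ : ℝ) (G : SimpleGraph V) : Set V :=
  {u | IsPositive θ G u ∧ ¬ IsSpecial θ G u}

/-- `G` is θ-super positive: `mult(θ,G) = 0` and `mult(θ,G\v) = 1` for every vertex `v`. -/
def IsSuperPositive (θ : ℝ) (G : SimpleGraph V) : Prop :=
  mult θ G = 0 ∧ ∀ v : V, mult θ (deleteVert G v) = 1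

/-- `G` is θ-elementary: θ-super positive and `P_θ(G\v) = ∅` for every vertex `v`. -/
def IsElementary (θ : ℝ) (G : SimpleGraph V) : Prop :=
  IsSuperPositive θ G ∧ ∀ v : V, positiveSet θ (deleteVert G v) = ∅

/-- `G` is θ-critical: every vertex is θ-essential and `mult(θ,G) = 1`. -/
def IsCritical (θ : ℝ) (G : SimpleGraph V) : Prop :=
  (∀ v : V, IsEssential θ G v) ∧ mult θ G = 1

/-- `c_θ(G)`: the number of θ-critical connected components of `G`. -/
noncomputable def numCritComponents (θ : ℝ) (G : SimpleGraph V) : ℕ :=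
  Nat.card {c : G.ConnectedComponent // IsCritical θ (G.induce c.supp)}

/-- `X` is a θ-barrier set: `mult(θ,G) = c_θ(G\X) - |X|`. -/
def IsBarrier (θ : ℝ) (G : SimpleGraph V) (X : Set V) : Prop :=
  numCritComponents θ (deleteSet G X) = mult θ G + X.ncard

/-- `X` is a θ-extreme set: `mult(θ,G\X) = mult(θ,G) + |X|`. -/
def IsExtreme (θ : ℝ) (G : SimpleGraph V) (X : Set V) : Prop :=
  mult θ (deleteSet G X) = mult θ G + X.ncard

/-- `G` is θ-base: θ-super positive and no θ-barrier set contains two adjacent vertices. -/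
def IsBase (θ : ℝ) (G : SimpleGraph V) : Prop :=
  IsSuperPositive θ G ∧
    ∀ X : Set V, IsBarrier θ G X → ∀ u v : V, u ∈ X → v ∈ X → ¬ G.Adj u v

section Matchings

variable [Fintype V]

open Classical in
/-- The matchings of `G` all of whose edges have both ends in `A`. -/
noncomputable def matchingsIn (G : SimpleGraph V) (A : Finset V) : Finset (Finset (Sym2 V)) :=
  Finset.univ.filter fun M => (M : Set (Sym2 V)) ⊆ G.edgeSet ∧
    ((M : Set (Sym2 V)).Pairwise fun e f => ∀ v : V, v ∈ e → v ∉ f) ∧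
    ∀ e ∈ M, ∀ v ∈ e, v ∈ A

/-- The matching polynomial of the subgraph of `G` induced by `A`, as a sum over matchings. -/
noncomputable def matchPolyIn (G : SimpleGraph V) (A : Finset V) : ℝ[X] :=
  ∑ M ∈ matchingsIn G A, C ((-1 : ℝ) ^ M.card) * X ^ (A.card - 2 * M.card)

theorem mem_matchingsIn {G : SimpleGraph V} {A : Finset V} {M : Finset (Sym2 V)} :
    M ∈ matchingsIn G A ↔ (M : Set (Sym2 V)) ⊆ G.edgeSet ∧
      ((M : Set (Sym2 V)).Pairwise fun e f => ∀ v : V, v ∈ e → v ∉ f) ∧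
      ∀ e ∈ M, ∀ v ∈ e, v ∈ A := by
  simp [matchingsIn]

theorem two_mul_card_le_of_mem_matchingsIn {G : SimpleGraph V} {A : Finset V}
    {M : Finset (Sym2 V)} (hM : M ∈ matchingsIn G A) : 2 * M.card ≤ A.card := by
  classical
  obtain ⟨hE, hP, hA⟩ := mem_matchingsIn.1 hM
  have hcard : (M.biUnion fun e => e.toFinset).card = ∑ e ∈ M, e.toFinset.card := by
    refine Finset.card_biUnion fun e he f hf hef => ?_
    refine Finset.disjoint_left.2 fun v hv hv' => ?_
    exact hP he hf hef v (Sym2.mem_toFinset.1 hv) (Sym2.mem_toFinset.1 hv')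
  have htwo : ∑ e ∈ M, e.toFinset.card = ∑ _e ∈ M, 2 :=
    Finset.sum_congr rfl fun e he =>
      Sym2.card_toFinset_of_not_isDiag e (G.not_isDiag_of_mem_edgeSet (hE he))
  have hsub : (M.biUnion fun e => e.toFinset) ⊆ A := by
    intro v hv
    obtain ⟨e, he, hve⟩ := Finset.mem_biUnion.1 hv
    exact hA e he v (Sym2.mem_toFinset.1 hve)
  have := Finset.card_le_card hsub
  rw [hcard, htwo] at this
  simpa [mul_comm] using this

theorem matchPolyIn_empty (G : SimpleGraph V) : matchPolyIn G ∅ = 1 := by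
  have h : matchingsIn G ∅ = {∅} := by
    ext M
    rw [Finset.mem_singleton]
    constructor
    · intro hM
      have := two_mul_card_le_of_mem_matchingsIn hM
      simpa using this
    · rintro rfl
      simp [mem_matchingsIn]
  simp [matchPolyIn, h]

open Classical in
/-- The vertex recurrence for the matching polynomial. -/
theorem matchPolyIn_eq (G : SimpleGraph V) {A : Finset V} {u : V} (hu : u ∈ A) :
    matchPolyIn G A = X * matchPolyIn G (A.erase u) -
      ∑ v ∈ A with G.Adj u v, matchPolyIn G ((A.erase u).erase v) := by
  have havoid : ((matchingsIn G A).filter fun M => ¬ ∃ e ∈ M, u ∈ e) =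
      matchingsIn G (A.erase u) := by
    ext M
    simp only [Finset.mem_filter, mem_matchingsIn, Finset.mem_erase]
    constructor
    · rintro ⟨⟨h1, h2, h3⟩, h4⟩
      refine ⟨h1, h2, fun e he v hv => ⟨?_, h3 e he v hv⟩⟩
      rintro rfl
      exact h4 ⟨e, he, hv⟩
    · rintro ⟨h1, h2, h3⟩
      exact ⟨⟨h1, h2, fun e he v hv => (h3 e he v hv).2⟩,
        fun ⟨e, he, hv⟩ => (h3 e he u hv).1 rfl⟩
  have hfresh : ∀ v, ∀ M ∈ matchingsIn G ((A.erase u).erase v), ∀ e ∈ M, u ∉ e ∧ v ∉ e := by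
    intro v M hM e he
    have h3 := (mem_matchingsIn.1 hM).2.2 e he
    exact ⟨fun h => by simpa using h3 u h, fun h => by simpa using h3 v h⟩
  have hcover : ∑ v ∈ A with G.Adj u v, ∑ M ∈ matchingsIn G ((A.erase u).erase v),
        C ((-1 : ℝ) ^ (M.card + 1)) * X ^ (A.card - 2 * (M.card + 1)) =
      ∑ M ∈ matchingsIn G A with ∃ e ∈ M, u ∈ e,
        C ((-1 : ℝ) ^ M.card) * X ^ (A.card - 2 * M.card) := by
    rw [Finset.sum_sigma']
    refine Finset.sum_bij (fun p _ => insert s(u, p.1) p.2) ?_ ?_ ?_ ?_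
    · rintro ⟨v, M⟩ hp
      obtain ⟨hv, hM⟩ := Finset.mem_sigma.1 hp
      obtain ⟨hvA, huv⟩ := Finset.mem_filter.1 hv
      have hf := hfresh v M hM
      obtain ⟨h1, h2, h3⟩ := mem_matchingsIn.1 hM
      refine Finset.mem_filter.2 ⟨mem_matchingsIn.2 ⟨?_, ?_, ?_⟩,
        s(u, v), Finset.mem_insert_self _ _, Sym2.mem_mk_left u v⟩
      · rw [Finset.coe_insert, Set.insert_subset_iff]
        exact ⟨huv, h1⟩
      · rw [Finset.coe_insert]
        refine h2.insert fun e he _ => ⟨fun w hw hwe => ?_, fun w hwe hw => ?_⟩ <;>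
        · rcases Sym2.mem_iff.1 hw with rfl | rfl
          · exact (hf e he).1 hwe
          · exact (hf e he).2 hwe
      · intro e he w hw
        rcases Finset.mem_insert.1 he with rfl | he
        · rcases Sym2.mem_iff.1 hw with rfl | rfl
          · exact hu
          · exact hvA
        · exact Finset.mem_of_mem_erase (Finset.mem_of_mem_erase (h3 e he w hw))
    · rintro ⟨v, M⟩ hp ⟨v', M'⟩ hp' heq
      have hf := hfresh v M (Finset.mem_sigma.1 hp).2
      have hf' := hfresh v' M' (Finset.mem_sigma.1 hp').2
      simp only at heq
      have hmem : s(u, v) ∈ insert s(u, v') M' := heq ▸ Finset.mem_insert_self _ _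
      have hvv : v = v' := by
        rcases Finset.mem_insert.1 hmem with h | h
        · exact Sym2.congr_right.1 h
        · exact absurd (Sym2.mem_mk_left u v) (hf' _ h).1
      subst hvv
      have hM : M = M' := by
        rw [← Finset.erase_insert (fun h => (hf _ h).1 (Sym2.mem_mk_left u v)), heq,
          Finset.erase_insert (fun h => (hf' _ h).1 (Sym2.mem_mk_left u v))]
      rw [hM]
    · intro M hM
      obtain ⟨hM, e, he, hue⟩ := Finset.mem_filter.1 hM
      obtain ⟨h1, h2, h3⟩ := mem_matchingsIn.1 hM
      obtain ⟨v, rfl⟩ := Sym2.mem_iff_exists.1 hue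
      have huv : G.Adj u v := h1 he
      refine ⟨⟨v, M.erase s(u, v)⟩, Finset.mem_sigma.2 ⟨Finset.mem_filter.2
        ⟨h3 _ he v (Sym2.mem_mk_right u v), huv⟩, mem_matchingsIn.2 ⟨?_, ?_, ?_⟩⟩,
        Finset.insert_erase he⟩
      · exact fun f hf => h1 (Finset.mem_of_mem_erase hf)
      · exact h2.mono fun f hf => Finset.mem_of_mem_erase hf
      · intro f hf w hw
        obtain ⟨hne, hfM⟩ := Finset.mem_erase.1 hf
        have hdis := h2 hfM he hne w hw
        refine Finset.mem_erase.2 ⟨?_, Finset.mem_erase.2 ⟨?_, h3 f hfM w hw⟩⟩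
        · rintro rfl
          exact hdis (Sym2.mem_mk_right u w)
        · rintro rfl
          exact hdis (Sym2.mem_mk_left w v)
    · rintro ⟨v, M⟩ hp
      have hf := hfresh v M (Finset.mem_sigma.1 hp).2
      rw [Finset.card_insert_of_notMem fun h => (hf _ h).1 (Sym2.mem_mk_left u v)]
  have hpos : 0 < A.card := Finset.card_pos.2 ⟨u, hu⟩
  rw [matchPolyIn, ← Finset.sum_filter_add_sum_filter_not _ (fun M => ∃ e ∈ M, u ∈ e), havoid,
    ← hcover, add_comm, sub_eq_add_neg, ← Finset.sum_neg_distrib, matchPolyIn, Finset.mul_sum]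
  congr 1
  · refine Finset.sum_congr rfl fun M hM => ?_
    have h2 := two_mul_card_le_of_mem_matchingsIn hM
    rw [Finset.card_erase_of_mem hu] at h2 ⊢
    rw [show A.card - 2 * M.card = A.card - 1 - 2 * M.card + 1 by omega]
    ring
  · refine Finset.sum_congr rfl fun v hv => ?_
    obtain ⟨hvA, huv⟩ := Finset.mem_filter.1 hv
    rw [matchPolyIn, ← Finset.sum_neg_distrib]
    refine Finset.sum_congr rfl fun M _ => ?_
    rw [Finset.card_erase_of_mem (Finset.mem_erase.2 ⟨huv.ne', hvA⟩), Finset.card_erase_of_mem hu,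
      show A.card - 2 * (M.card + 1) = A.card - 1 - 1 - 2 * M.card by omega, pow_succ]
    simp

open Classical in
/-- The matching polynomial of a graph embedded in `G` as an induced subgraph. -/
theorem matchingPoly_eq_matchPolyIn {W : Type*} {H : SimpleGraph W} {G : SimpleGraph V}
    (f : H ↪g G) {A : Finset V} (hA : ∀ v, v ∈ A ↔ v ∈ Set.range f) :
    matchingPoly H = matchPolyIn G A := by
  have hfin : Finite W := Finite.of_injective f f.injective
  have := Fintype.ofFinite W
  have hcard : Nat.card W = A.card := by
    have : A = Finset.univ.map f.toEmbedding := by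
      ext v
      simp [hA]
    rw [this, Finset.card_map, Nat.card_eq_fintype_card, Finset.card_univ]
  have hedge : ∀ e : Sym2 W, Sym2.map f e ∈ G.edgeSet ↔ e ∈ H.edgeSet := by
    intro e
    induction e with | _ a b
    simp
  have hnum : ∀ r, numMatchings H r = ((matchingsIn G A).filter fun M => M.card = r).card := by
    intro r
    rw [numMatchings, Nat.card_eq_fintype_card, Fintype.card_subtype]
    refine Finset.card_bij (fun M _ => M.map f.toEmbedding.sym2Map) ?_ ?_ ?_
    · intro M hM
      obtain ⟨-, hr, h1, h2⟩ := Finset.mem_filter.1 hM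
      refine Finset.mem_filter.2 ⟨mem_matchingsIn.2 ⟨?_, ?_, ?_⟩, by simpa using hr⟩
      · intro _ hmem
        obtain ⟨e, he, rfl⟩ := Finset.mem_map.1 hmem
        exact (hedge e).2 (h1 he)
      · intro _ hmem _ hmem' hne v hv hv'
        obtain ⟨e, he, rfl⟩ := Finset.mem_map.1 hmem
        obtain ⟨e', he', rfl⟩ := Finset.mem_map.1 hmem'
        obtain ⟨a, ha, rfl⟩ := Sym2.mem_map.1 hv
        obtain ⟨b, hb, hab⟩ := Sym2.mem_map.1 hv'
        obtain rfl : b = a := f.injective hab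
        exact h2 he he' (fun h => hne (by rw [h])) b ha hb
      · intro _ hmem v hv
        obtain ⟨e, he, rfl⟩ := Finset.mem_map.1 hmem
        obtain ⟨a, ha, rfl⟩ := Sym2.mem_map.1 hv
        exact (hA _).2 ⟨a, rfl⟩
    · intro M _ M' _ h
      exact Finset.map_injective _ h
    · intro M hM
      obtain ⟨hM, hr⟩ := Finset.mem_filter.1 hM
      obtain ⟨h1, h2, h3⟩ := mem_matchingsIn.1 hM
      have hmap : (Finset.univ.filter fun e => Sym2.map f e ∈ M).map f.toEmbedding.sym2Map = M := by
        ext e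
        constructor
        · intro hmem
          obtain ⟨e, he, rfl⟩ := Finset.mem_map.1 hmem
          exact (Finset.mem_filter.1 he).2
        · intro he
          refine Finset.mem_map.2 ?_
          induction e with | _ a b
          obtain ⟨a, rfl⟩ := (hA a).1 (h3 _ he a (Sym2.mem_mk_left a b))
          obtain ⟨b, rfl⟩ := (hA b).1 (h3 _ he b (Sym2.mem_mk_right _ b))
          exact ⟨s(a, b), Finset.mem_filter.2 ⟨Finset.mem_univ _, he⟩, rfl⟩
      refine ⟨_, Finset.mem_filter.2 ⟨Finset.mem_univ _, ?_, ?_, ?_⟩, hmap⟩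
      · rw [← Finset.card_map f.toEmbedding.sym2Map, hmap, hr]
      · intro e he
        exact (hedge e).1 (h1 (Finset.mem_filter.1 he).2)
      · intro e he e' he' hne v hv hv'
        exact h2 (Finset.mem_filter.1 he).2 (Finset.mem_filter.1 he').2
          (fun h => hne (Sym2.map.injective f.injective h)) (f v)
          (Sym2.mem_map.2 ⟨v, hv, rfl⟩) (Sym2.mem_map.2 ⟨v, hv', rfl⟩)
  have hmaps : ∀ M ∈ matchingsIn G A, M.card ∈ Finset.range (A.card + 1) := by
    intro M hM
    have := two_mul_card_le_of_mem_matchingsIn hM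
    rw [Finset.mem_range]
    omega
  rw [matchingPoly, matchPolyIn, ← Finset.sum_fiberwise_of_maps_to hmaps, hcard]
  refine Finset.sum_congr rfl fun r _ => ?_
  rw [hnum, Finset.sum_congr rfl (g := fun _ => C ((-1 : ℝ) ^ r) * X ^ (A.card - 2 * r))
    fun M hM => by rw [(Finset.mem_filter.1 hM).2]]
  simp
  ring

end Matchings

section Polynomials

theorem eval_nonneg_of_forall_gt {f : ℝ[X]} {θ : ℝ} (h : ∀ x, θ < x → 0 ≤ f.eval x) :
    0 ≤ f.eval θ := by
  have ht : Filter.Tendsto (fun x => f.eval x) (nhdsWithin θ (Set.Ioi θ)) (nhds (f.eval θ)) :=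
    f.continuous.continuousWithinAt
  exact ge_of_tendsto ht (Filter.eventually_of_mem self_mem_nhdsWithin h)

theorem eval_nonpos_of_forall_lt {f : ℝ[X]} {θ : ℝ} (h : ∀ x, x < θ → f.eval x ≤ 0) :
    f.eval θ ≤ 0 := by
  have ht : Filter.Tendsto (fun x => f.eval x) (nhdsWithin θ (Set.Iio θ)) (nhds (f.eval θ)) :=
    f.continuous.continuousWithinAt
  exact le_of_tendsto ht (Filter.eventually_of_mem self_mem_nhdsWithin h)

theorem eval_eq_zero_of_forall_mul_nonneg {f : ℝ[X]} {θ : ℝ}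
    (h : ∀ x, 0 ≤ ((X - C θ) * f).eval x) : f.eval θ = 0 := by
  refine le_antisymm (eval_nonpos_of_forall_lt fun x hx => ?_)
    (eval_nonneg_of_forall_gt fun x hx => ?_)
  · have := h x
    simp only [eval_mul, eval_sub, eval_X, eval_C] at this
    by_contra! hf
    nlinarith [mul_pos (sub_pos.2 hx) hf]
  · have := h x
    simp only [eval_mul, eval_sub, eval_X, eval_C] at this
    exact nonneg_of_mul_nonneg_right this (sub_pos.2 hx)

/-- If `p' * q - p * q'` dominates `q ^ 2`, then a root of `p` of multiplicity `k + 1`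
is a root of `q` of multiplicity at least `k`. -/
theorem rootMultiplicity_le_of_sq_le_wronskian {p q : ℝ[X]} (hp : p ≠ 0) (hq : q ≠ 0)
    (h : ∀ x, q.eval x ^ 2 ≤ (derivative p * q - p * derivative q).eval x) (θ : ℝ) :
    p.rootMultiplicity θ ≤ q.rootMultiplicity θ + 1 := by
  by_contra! hlt
  obtain ⟨Q, hQ, hQθ⟩ := exists_eq_pow_rootMultiplicity_mul_and_not_dvd q hq θ
  have hqd := Dvd.intro _ hQ.symm
  generalize q.rootMultiplicity θ = k at hlt hQ hqd
  have hpd : (X - C θ) ^ (k + 2) ∣ p := (le_rootMultiplicity_iff hp).1 (by omega)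
  have hpd' : (X - C θ) ^ (k + 2 - 1) ∣ derivative p := pow_sub_one_dvd_derivative_of_pow_dvd hpd
  have hqd' : (X - C θ) ^ (k - 1) ∣ derivative q := pow_sub_one_dvd_derivative_of_pow_dvd hqd
  have hW : (X - C θ) ^ (2 * k + 1) ∣ derivative p * q - p * derivative q := by
    refine dvd_sub ?_ ?_
    · have hmul := mul_dvd_mul hpd' hqd
      rw [← pow_add] at hmul
      exact (pow_dvd_pow _ (by omega)).trans hmul
    · have hmul := mul_dvd_mul hpd hqd'
      rw [← pow_add] at hmul
      exact (pow_dvd_pow _ (by omega)).trans hmul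
  obtain ⟨R, hR⟩ := hW
  have hQne : Q.eval θ ≠ 0 := fun h0 => hQθ (dvd_iff_isRoot.2 h0)
  have hle : 0 ≤ ((X - C θ) * R - Q ^ 2).eval θ := by
    refine eval_nonneg_of_forall_gt fun x hx => ?_
    have hx' := h x
    rw [hR, hQ] at hx'
    simp only [eval_mul, eval_pow, eval_sub, eval_X, eval_C] at hx' ⊢
    have hpow : 0 < (x - θ) ^ (2 * k) := pow_pos (sub_pos.2 hx) _
    refine nonneg_of_mul_nonneg_right ?_ hpow
    have e1 : ((x - θ) ^ k * Q.eval x) ^ 2 = (x - θ) ^ (2 * k) * Q.eval x ^ 2 := by ring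
    have e2 : (x - θ) ^ (2 * k + 1) * R.eval x = (x - θ) ^ (2 * k) * ((x - θ) * R.eval x) := by
      ring
    rw [e1, e2] at hx'
    rw [mul_sub]
    exact sub_nonneg.2 hx'
  simp only [eval_mul, eval_pow, eval_sub, eval_X, eval_C, sub_self, zero_mul, zero_sub] at hle
  have := pow_pos (abs_pos.2 hQne) 2
  rw [sq_abs] at this
  linarith

end Polynomials

section Multiplicity

variable [Fintype V]

open Classical in
theorem sq_eval_le_wronskian (G : SimpleGraph V) (A : Finset V) {u : V} (hu : u ∈ A) (x : ℝ) :
    (matchPolyIn G (A.erase u)).eval x ^ 2 ≤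
      (derivative (matchPolyIn G A) * matchPolyIn G (A.erase u) -
        matchPolyIn G A * derivative (matchPolyIn G (A.erase u))).eval x := by
  induction A using Finset.strongInduction generalizing u with
  | H A ih =>
    have hW : derivative (matchPolyIn G A) * matchPolyIn G (A.erase u) -
        matchPolyIn G A * derivative (matchPolyIn G (A.erase u)) =
        matchPolyIn G (A.erase u) ^ 2 + ∑ v ∈ A with G.Adj u v,
          (derivative (matchPolyIn G (A.erase u)) * matchPolyIn G ((A.erase u).erase v) -
            matchPolyIn G (A.erase u) * derivative (matchPolyIn G ((A.erase u).erase v))) := by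
      rw [matchPolyIn_eq G hu, Finset.sum_sub_distrib, ← Finset.mul_sum, ← Finset.mul_sum,
        derivative_sub, derivative_mul, derivative_X, derivative_sum]
      ring
    rw [hW, eval_add, eval_pow, eval_finsetSum, le_add_iff_nonneg_right]
    refine Finset.sum_nonneg fun v hv => ?_
    obtain ⟨hvA, huv⟩ := Finset.mem_filter.1 hv
    exact (sq_nonneg _).trans
      (ih (A.erase u) (Finset.erase_ssubset hu) (Finset.mem_erase.2 ⟨huv.ne', hvA⟩))

theorem matchPolyIn_ne_zero (G : SimpleGraph V) (A : Finset V) : matchPolyIn G A ≠ 0 := by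
  classical
  induction A using Finset.induction_on with
  | empty => simp [matchPolyIn_empty]
  | insert u A hu ih =>
    intro h0
    refine ih (Polynomial.funext fun x => ?_)
    have := sq_eval_le_wronskian G (insert u A) (Finset.mem_insert_self u A) x
    rw [h0, Finset.erase_insert hu] at this
    simp only [derivative_zero, zero_mul, sub_self, eval_zero] at this
    simpa using pow_eq_zero_iff two_ne_zero |>.1 (le_antisymm this (sq_nonneg _))

open Classical in
theorem eval_mul_sub_mul_nonneg (G : SimpleGraph V) (A : Finset V) {u v : V} (hu : u ∈ A)
    (hv : v ∈ A) (huv : u ≠ v) (x : ℝ) :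
    0 ≤ (matchPolyIn G (A.erase u) * matchPolyIn G (A.erase v) -
      matchPolyIn G A * matchPolyIn G ((A.erase u).erase v)).eval x := by
  induction A using Finset.strongInduction generalizing u with
  | H A ih =>
    have hsplit : ∀ F : V → ℝ[X], ∑ w ∈ A with G.Adj u w, F w =
        ∑ w ∈ A.erase v with G.Adj u w, F w + if G.Adj u v then F v else 0 := by
      intro F
      rw [Finset.sum_filter, Finset.sum_filter, Finset.sum_erase_add _ _ hv]
    have hF : matchPolyIn G (A.erase u) * matchPolyIn G (A.erase v) -
        matchPolyIn G A * matchPolyIn G ((A.erase u).erase v) =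
        ∑ w ∈ A.erase v with G.Adj u w,
          (matchPolyIn G ((A.erase u).erase w) * matchPolyIn G ((A.erase u).erase v) -
            matchPolyIn G (A.erase u) * matchPolyIn G (((A.erase u).erase v).erase w)) +
        (if G.Adj u v then matchPolyIn G ((A.erase u).erase v) else 0) *
          matchPolyIn G ((A.erase u).erase v) := by
      rw [matchPolyIn_eq G hu, matchPolyIn_eq G (Finset.mem_erase.2 ⟨huv, hu⟩), hsplit,
        Finset.sum_sub_distrib, ← Finset.mul_sum, ← Finset.sum_mul,
        Finset.erase_right_comm (a := v) (b := u)]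
      ring
    rw [hF, eval_add, eval_finsetSum]
    refine add_nonneg (Finset.sum_nonneg fun w hw => ?_) ?_
    · obtain ⟨hwA, huw⟩ := Finset.mem_filter.1 hw
      obtain ⟨hwv, hwA⟩ := Finset.mem_erase.1 hwA
      rw [Finset.erase_right_comm (a := v) (b := w)]
      exact ih (A.erase u) (Finset.erase_ssubset hu) (Finset.mem_erase.2 ⟨huw.ne', hwA⟩)
        (Finset.mem_erase.2 ⟨huv.symm, hv⟩) hwv
    · split_ifs
      · rw [eval_mul]
        exact mul_self_nonneg _
      · simp

/-- The multiplicity of `θ` as a root of the matching polynomial of the subgraph induced by `A`. -/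
noncomputable def multIn (θ : ℝ) (G : SimpleGraph V) (A : Finset V) : ℕ :=
  (matchPolyIn G A).rootMultiplicity θ

theorem mult_eq_multIn (θ : ℝ) {W : Type*} {H : SimpleGraph W} {G : SimpleGraph V}
    (f : H ↪g G) {A : Finset V} (hA : ∀ v, v ∈ A ↔ v ∈ Set.range f) :
    mult θ H = multIn θ G A := by
  rw [mult, matchingPoly_eq_matchPolyIn f hA, multIn]

variable [DecidableEq V]

theorem multIn_le_multIn_erase_add_one (θ : ℝ) (G : SimpleGraph V) {A : Finset V} {u : V}
    (hu : u ∈ A) : multIn θ G A ≤ multIn θ G (A.erase u) + 1 := by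
  refine rootMultiplicity_le_of_sq_le_wronskian (matchPolyIn_ne_zero G A)
    (matchPolyIn_ne_zero G _) (fun x => ?_) θ
  convert sq_eval_le_wronskian G A hu x

theorem multIn_erase_le (θ : ℝ) (G : SimpleGraph V) {A : Finset V} {u : V} (hu : u ∈ A) :
    multIn θ G (A.erase u) ≤ multIn θ G A + 1 := by
  classical
  rw [← Nat.sub_le_iff_le_add]
  refine (le_rootMultiplicity_iff (matchPolyIn_ne_zero G A)).2 ?_
  have hrec : matchPolyIn G A = X * matchPolyIn G (A.erase u) -
      ∑ v ∈ A with G.Adj u v, matchPolyIn G ((A.erase u).erase v) := by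
    convert matchPolyIn_eq G hu
  rw [hrec]
  refine dvd_sub (Dvd.dvd.mul_left ?_ _) (Finset.dvd_sum fun v hv => ?_)
  · exact (le_rootMultiplicity_iff (matchPolyIn_ne_zero G _)).1 (Nat.sub_le _ _)
  · obtain ⟨hvA, huv⟩ := Finset.mem_filter.1 hv
    refine (le_rootMultiplicity_iff (matchPolyIn_ne_zero G _)).1 ?_
    exact Nat.sub_le_iff_le_add.2
      (multIn_le_multIn_erase_add_one θ G (Finset.mem_erase.2 ⟨huv.ne', hvA⟩))

theorem multIn_sdiff_le (θ : ℝ) (G : SimpleGraph V) {A B : Finset V} (hB : B ⊆ A) :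
    multIn θ G (A \ B) ≤ multIn θ G A + B.card := by
  induction B using Finset.induction_on with
  | empty => simp
  | insert b B hb ih =>
    obtain ⟨hbA, hBA⟩ := Finset.insert_subset_iff.1 hB
    rw [Finset.sdiff_insert, Finset.card_insert_of_notMem hb]
    have := multIn_erase_le θ G (Finset.mem_sdiff.2 ⟨hbA, hb⟩)
    have := ih hBA
    omega

/-- If `θ` is not a root and `u`, `v` are distinct `θ`-positive vertices, then `v` is not
`θ`-neutral once `u` is deleted. -/
theorem multIn_erase_erase_ne_one {θ : ℝ} {G : SimpleGraph V} {A : Finset V} {u v : V}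
    (hu : u ∈ A) (hv : v ∈ A) (huv : u ≠ v) (hA : multIn θ G A = 0)
    (hAu : multIn θ G (A.erase u) = 1) (hAv : multIn θ G (A.erase v) = 1) :
    multIn θ G ((A.erase u).erase v) ≠ 1 := by
  intro hone
  obtain ⟨P, hP, -⟩ :=
    exists_eq_pow_rootMultiplicity_mul_and_not_dvd _ (matchPolyIn_ne_zero G (A.erase u)) θ
  obtain ⟨Q, hQ, -⟩ :=
    exists_eq_pow_rootMultiplicity_mul_and_not_dvd _ (matchPolyIn_ne_zero G (A.erase v)) θ
  obtain ⟨R, hR, hRθ⟩ := exists_eq_pow_rootMultiplicity_mul_and_not_dvd _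
    (matchPolyIn_ne_zero G ((A.erase u).erase v)) θ
  rw [multIn] at hA hAu hAv hone
  rw [hAu, pow_one] at hP
  rw [hAv, pow_one] at hQ
  rw [hone, pow_one] at hR
  have hne : (matchPolyIn G A).eval θ ≠ 0 := by
    intro h0
    have := (rootMultiplicity_pos (matchPolyIn_ne_zero G A)).2 h0
    omega
  have hfac : (X - C θ) * ((X - C θ) * P * Q - matchPolyIn G A * R) =
      matchPolyIn G (A.erase u) * matchPolyIn G (A.erase v) -
        matchPolyIn G A * matchPolyIn G ((A.erase u).erase v) := by
    rw [hP, hQ, hR]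
    ring
  have h0 := eval_eq_zero_of_forall_mul_nonneg (θ := θ)
    (f := (X - C θ) * P * Q - matchPolyIn G A * R) fun x => by
      rw [hfac]
      convert eval_mul_sub_mul_nonneg G A hu hv huv x
  simp only [eval_mul, eval_sub, eval_X, eval_C, sub_self, zero_mul, zero_sub, neg_eq_zero,
    mul_eq_zero] at h0
  exact h0.elim hne fun h => hRθ (dvd_iff_isRoot.2 h)

theorem matchPolyIn_union (G : SimpleGraph V) (A B : Finset V) (hAB : Disjoint A B)
    (hadj : ∀ a ∈ A, ∀ b ∈ B, ¬ G.Adj a b) :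
    matchPolyIn G (A ∪ B) = matchPolyIn G A * matchPolyIn G B := by
  classical
  induction A using Finset.strongInduction with
  | H A ih =>
    rcases A.eq_empty_or_nonempty with rfl | ⟨u, hu⟩
    · simp [matchPolyIn_empty]
    · have hsub : ∀ A', A' ⊂ A → matchPolyIn G (A' ∪ B) = matchPolyIn G A' * matchPolyIn G B :=
        fun A' h => ih A' h (hAB.mono_left h.subset) fun a ha => hadj a (h.subset ha)
      have hrec : ∀ {D : Finset V}, u ∈ D → matchPolyIn G D = X * matchPolyIn G (D.erase u) -
          ∑ v ∈ D with G.Adj u v, matchPolyIn G ((D.erase u).erase v) := by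
        intro D hD
        convert matchPolyIn_eq G hD
      have herase : ∀ D : Finset V, ∀ a ∈ A, (D ∪ B).erase a = D.erase a ∪ B := fun D a ha => by
        rw [Finset.erase_union_distrib, Finset.erase_eq_of_notMem (s := B)
          (Finset.disjoint_left.1 hAB ha)]
      have hfilter : ((A ∪ B).filter fun v => G.Adj u v) = A.filter fun v => G.Adj u v := by
        rw [Finset.filter_union, Finset.filter_false_of_mem (s := B) (hadj u hu),
          Finset.union_empty]
      rw [hrec (Finset.mem_union_left B hu), hrec hu, hfilter, herase A u hu,
        hsub _ (Finset.erase_ssubset hu), sub_mul, Finset.sum_mul, mul_assoc]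
      congr 1
      refine Finset.sum_congr rfl fun v hv => ?_
      rw [herase _ v (Finset.mem_filter.1 hv).1, hsub]
      exact (Finset.erase_subset _ _).trans_ssubset (Finset.erase_ssubset hu)

theorem multIn_eq_add_sdiff (θ : ℝ) (G : SimpleGraph V) {A B : Finset V} (hBA : B ⊆ A)
    (hadj : ∀ b ∈ B, ∀ a ∈ A, G.Adj b a → a ∈ B) :
    multIn θ G A = multIn θ G B + multIn θ G (A \ B) := by
  have hu := matchPolyIn_union G B (A \ B) Finset.disjoint_sdiff fun b hb a ha h =>
    (Finset.mem_sdiff.1 ha).2 (hadj b hb a (Finset.mem_sdiff.1 ha).1 h)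
  rw [Finset.union_sdiff_of_subset hBA] at hu
  rw [multIn, hu, rootMultiplicity_mul (mul_ne_zero (matchPolyIn_ne_zero G _)
    (matchPolyIn_ne_zero G _)), multIn, multIn]

/-- The multiplicity of `θ` is at least the number of unions of components having `θ` as root. -/
theorem card_le_multIn (θ : ℝ) (G : SimpleGraph V) {ι : Type*} (I : Finset ι) (B : ι → Finset V)
    (A : Finset V) (hBA : ∀ i ∈ I, B i ⊆ A)
    (hdis : ∀ i ∈ I, ∀ j ∈ I, i ≠ j → Disjoint (B i) (B j))
    (hadj : ∀ i ∈ I, ∀ b ∈ B i, ∀ a ∈ A, G.Adj b a → a ∈ B i)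
    (hpos : ∀ i ∈ I, 0 < multIn θ G (B i)) : I.card ≤ multIn θ G A := by
  classical
  induction I using Finset.induction_on generalizing A with
  | empty => simp
  | insert i I hi ih =>
    have hmem := Finset.mem_insert_self i I
    have hIH := ih (A \ B i)
      (fun j hj => Finset.subset_sdiff.2 ⟨hBA j (Finset.mem_insert_of_mem hj),
        hdis j (Finset.mem_insert_of_mem hj) i hmem (ne_of_mem_of_not_mem hj hi)⟩)
      (fun j hj k hk => hdis j (Finset.mem_insert_of_mem hj) k (Finset.mem_insert_of_mem hk))
      (fun j hj b hb a ha => hadj j (Finset.mem_insert_of_mem hj) b hb a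
        (Finset.mem_sdiff.1 ha).1)
      (fun j hj => hpos j (Finset.mem_insert_of_mem hj))
    rw [Finset.card_insert_of_notMem hi, multIn_eq_add_sdiff θ G (hBA i hmem) (hadj i hmem)]
    have := hpos i hmem
    omega

end Multiplicity

/-- In a θ-elementary graph, a nonempty S is a θ-barrier set iff G\S has exactly |S|
components and each of them is θ-critical. -/
theorem stmt_10 {V : Type*} [Fintype V] (θ : ℝ) (G : SimpleGraph V)
    (h : IsElementary θ G) (S : Set V) (hSne : S.Nonempty) :
    IsBarrier θ G S ↔
      (Nat.card (deleteSet G S).ConnectedComponent = S.ncard ∧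
        ∀ c : (deleteSet G S).ConnectedComponent,
          IsCritical θ ((deleteSet G S).induce c.supp)) := by
  classical
  obtain ⟨⟨hG, hGv⟩, hpos⟩ := h
  have hm0 : multIn θ G Finset.univ = 0 := by
    rw [← mult_eq_multIn θ (SimpleGraph.Embedding.refl (G := G)) (by simp)]
    exact hG
  have hdel : ∀ v, mult θ (deleteVert G v) = multIn θ G (Finset.univ.erase v) := fun v =>
    mult_eq_multIn θ (SimpleGraph.Embedding.induce _) (by simp [SimpleGraph.Embedding.induce])
  have hdel2 : ∀ v, ∀ w : ({v}ᶜ : Set V), mult θ (deleteVert (deleteVert G v) w) =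
      multIn θ G ((Finset.univ.erase v).erase w) := by
    intro v w
    refine mult_eq_multIn θ ((SimpleGraph.Embedding.induce _).trans
      (SimpleGraph.Embedding.induce _)) fun x => ?_
    constructor
    · intro hx
      obtain ⟨hxw, hxv, -⟩ := by simpa only [Finset.mem_erase] using hx
      exact ⟨⟨⟨x, hxv⟩, fun h => hxw (congrArg Subtype.val h)⟩, rfl⟩
    · rintro ⟨⟨⟨y, hyv⟩, hyw⟩, rfl⟩
      exact Finset.mem_erase.2 ⟨fun h => hyw (Subtype.ext h),
        Finset.mem_erase.2 ⟨hyv, Finset.mem_univ _⟩⟩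
  have hm1 : ∀ v, multIn θ G (Finset.univ.erase v) = 1 := fun v => by rw [← hdel, hGv]
  set B : (deleteSet G S).ConnectedComponent → Finset V := fun c =>
    Finset.univ.filter fun v => ∃ hv : v ∈ Sᶜ, (deleteSet G S).connectedComponentMk ⟨v, hv⟩ = c
    with hB
  have hmemB : ∀ {c v}, v ∈ B c ↔
      ∃ hv : v ∈ Sᶜ, (deleteSet G S).connectedComponentMk ⟨v, hv⟩ = c := by
    simp [hB]
  have hcomp : ∀ c, mult θ ((deleteSet G S).induce c.supp) = multIn θ G (B c) := by
    intro c
    refine mult_eq_multIn θ ((SimpleGraph.Embedding.induce _).trans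
      (SimpleGraph.Embedding.induce _)) fun x => ?_
    rw [hmemB]
    constructor
    · rintro ⟨hx, hxc⟩
      exact ⟨⟨⟨x, hx⟩, hxc⟩, rfl⟩
    · rintro ⟨⟨⟨y, hy⟩, hyc⟩, rfl⟩
      exact ⟨hy, hyc⟩
  have hBadj : ∀ c, ∀ b ∈ B c, ∀ a, a ∉ S → G.Adj b a → a ∈ B c := by
    intro c b hb a ha hab
    obtain ⟨hbS, rfl⟩ := hmemB.1 hb
    refine hmemB.2 ⟨ha, SimpleGraph.ConnectedComponent.sound ?_⟩
    have : (deleteSet G S).Adj ⟨a, ha⟩ ⟨b, hbS⟩ := hab.symm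
    exact this.reachable
  have hSc : S.ncard = S.toFinset.card := Set.ncard_eq_toFinset_card' S
  constructor
  · intro hbar
    have hall : ∀ c : (deleteSet G S).ConnectedComponent, IsCritical θ ((deleteSet G S).induce c.supp) := by
      by_contra! hex
      obtain ⟨c, hc⟩ := hex
      obtain ⟨⟨u, huS⟩, hu⟩ := c.nonempty_supp
      have huB : u ∈ B c := hmemB.2 ⟨huS, hu⟩
      have hcrit : ∀ w ∈ B c,
          S.toFinset.card ≤ multIn θ G ((Finset.univ \ S.toFinset).erase w) := by
        intro w hw
        have hcount := card_le_multIn θ G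
          (Finset.univ.filter fun d => IsCritical θ ((deleteSet G S).induce d.supp)) B
          ((Finset.univ \ S.toFinset).erase w) ?_ ?_ ?_ ?_
        · rw [IsBarrier, hG, zero_add, hSc, numCritComponents, Nat.card_eq_fintype_card,
            Fintype.card_subtype] at hbar
          rwa [hbar] at hcount
        · intro d hd v hv
          obtain ⟨hvS, rfl⟩ := hmemB.1 hv
          refine Finset.mem_erase.2 ⟨?_, by simpa using hvS⟩
          rintro rfl
          obtain ⟨_, rfl⟩ := hmemB.1 hw
          exact hc (Finset.mem_filter.1 hd).2
        · intro d _ d' _ hne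
          refine Finset.disjoint_left.2 fun v hv hv' => hne ?_
          obtain ⟨_, rfl⟩ := hmemB.1 hv
          obtain ⟨_, rfl⟩ := hmemB.1 hv'
          rfl
        · intro d _ b hb a ha hab
          exact hBadj d b hb a (by simpa using (Finset.mem_erase.1 ha).2) hab
        · intro d hd
          rw [← hcomp, (Finset.mem_filter.1 hd).2.2]
          exact one_pos
      obtain ⟨x, hx⟩ := hSne
      have hlow : ∀ w ∈ B c, 1 ≤ multIn θ G ((Finset.univ.erase x).erase w) := by
        intro w hw
        obtain ⟨hwS, -⟩ := hmemB.1 hw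
        have h1 := hcrit w hw
        have hxS : x ∈ S.toFinset := Set.mem_toFinset.2 hx
        have h2 := multIn_sdiff_le θ G (A := (Finset.univ.erase x).erase w)
          (B := S.toFinset.erase x) fun v hv => by
            obtain ⟨hvx, hvS⟩ := Finset.mem_erase.1 hv
            simp only [Finset.mem_erase, Finset.mem_univ, and_true]
            exact ⟨fun h => hwS (h ▸ Set.mem_toFinset.1 hvS), hvx⟩
        have heq : (Finset.univ.erase x).erase w \ S.toFinset.erase x =
            (Finset.univ \ S.toFinset).erase w := by
          ext v
          by_cases hvx : v = x <;> simp [hvx, hx]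
        have hpos' : 0 < S.toFinset.card := Finset.card_pos.2 ⟨x, hxS⟩
        rw [heq, Finset.card_erase_of_mem hxS] at h2
        omega
      have hux : u ≠ x := fun h => huS (h ▸ hx)
      have hne := multIn_erase_erase_ne_one (Finset.mem_univ x) (Finset.mem_univ u) hux.symm hm0
        (hm1 x) (hm1 u)
      have hup := multIn_erase_le θ G (A := Finset.univ.erase x) (u := u) (by simpa using hux)
      have htwo : multIn θ G ((Finset.univ.erase x).erase u) = 2 := by
        have := hlow u huB
        have := hm1 x
        omega
      have hspec : IsSpecial θ (deleteVert G x) ⟨u, hux⟩ := by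
        by_contra hns
        have : (⟨u, hux⟩ : ({x}ᶜ : Set V)) ∈ positiveSet θ (deleteVert G x) := by
          refine ⟨?_, hns⟩
          rw [IsPositive, hdel2, hGv, htwo]
        rw [hpos x] at this
        exact this
      obtain ⟨-, ⟨w, hwx⟩, huw, hw⟩ := hspec
      have huw' : G.Adj u w := huw
      have hw0 : multIn θ G ((Finset.univ.erase x).erase w) = 0 := by
        rw [IsEssential, hdel2, hGv] at hw
        simpa using hw
      by_cases hwS : w ∈ S
      · have hxS : x ∈ S.toFinset := Set.mem_toFinset.2 hx
        have hwT : w ∈ S.toFinset.erase x := Finset.mem_erase.2 ⟨hwx, Set.mem_toFinset.2 hwS⟩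
        have h1 := hcrit u huB
        have h2 := multIn_sdiff_le θ G (A := (Finset.univ.erase x).erase w)
          (B := insert u ((S.toFinset.erase x).erase w)) fun v hv => by
            rcases Finset.mem_insert.1 hv with rfl | hv
            · simpa using ⟨huw'.ne, hux⟩
            · simp only [Finset.mem_erase] at hv ⊢
              exact ⟨hv.1, hv.2.1, Finset.mem_univ v⟩
        have heq : (Finset.univ.erase x).erase w \ insert u ((S.toFinset.erase x).erase w) =
            (Finset.univ \ S.toFinset).erase u := by
          ext v
          by_cases hvx : v = x
          · simp [hvx, hx]
          · by_cases hvw : v = w <;> simp [hvx, hvw, hwS]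
        have hins := Finset.card_insert_le u ((S.toFinset.erase x).erase w)
        have hpos₁ := Finset.card_pos.2 ⟨x, hxS⟩
        have hpos₂ := Finset.card_pos.2 ⟨w, hwT⟩
        rw [heq, hw0] at h2
        rw [Finset.card_erase_of_mem hwT] at hins
        rw [Finset.card_erase_of_mem hxS] at hins hpos₂
        omega
      · have := hlow w (hBadj c u huB w hwS huw')
        omega
    refine ⟨?_, hall⟩
    rw [IsBarrier, hG, zero_add, numCritComponents] at hbar
    rw [← hbar]
    exact (Nat.card_congr (Equiv.subtypeUnivEquiv hall)).symm
  · rintro ⟨hcard, hall⟩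
    rw [IsBarrier, hG, zero_add, numCritComponents, ← hcard]
    exact Nat.card_congr (Equiv.subtypeUnivEquiv hall)

end MatchPoly
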